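/- arXiv:1908.01327 — 5 statements merged into one kernel-verified Lean document; each statement's English description precedes it below -/
import Mathlib

section
/- Descent lemma for the block decomposition: for any p, q ∈ W, F(p) ≤ F(q) + ⟨∇F(q), p − q⟩ + N_c · D(p, q), where D(p, q) = Σ_{k=1}^{N_c} (1/2)‖div R_k* R_k (p − q)‖₂². -/
open Finset

noncomputable section

/-- The discrete image domain of `M × N` pixels. -/
abbrev Idx (M N : ℕ) := Fin M × Fin N

/-- The discrete divergence operator `div : W → V`, the negative adjoint of
the discrete gradient. -/
def divOp {M N : ℕ} (p : Idx M N → ℝ × ℝ) : Idx M N → ℝ := fun x =>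
  ((if (x.1 : ℕ) + 1 < M then (p x).1 else 0)
    - (if 1 ≤ (x.1 : ℕ) then
        (p (⟨(x.1 : ℕ) - 1, lt_of_le_of_lt (Nat.sub_le _ _) x.1.isLt⟩, x.2)).1 else 0))
  + ((if (x.2 : ℕ) + 1 < N then (p x).2 else 0)
    - (if 1 ≤ (x.2 : ℕ) then
        (p (x.1, ⟨(x.2 : ℕ) - 1, lt_of_le_of_lt (Nat.sub_le _ _) x.2.isLt⟩)).2 else 0))

/-- The discrete gradient operator `∇ : V → W`. -/
def gradOp {M N : ℕ} (u : Idx M N → ℝ) : Idx M N → ℝ × ℝ := fun x =>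
  ((if h : (x.1 : ℕ) + 1 < M then u (⟨(x.1 : ℕ) + 1, h⟩, x.2) - u x else 0),
   (if h : (x.2 : ℕ) + 1 < N then u (x.1, ⟨(x.2 : ℕ) + 1, h⟩) - u x else 0))

/-- Euclidean inner product on `V`. -/
def innerV {M N : ℕ} (u v : Idx M N → ℝ) : ℝ := ∑ x, u x * v x

/-- Euclidean inner product on `W`. -/
def innerW {M N : ℕ} (p q : Idx M N → ℝ × ℝ) : ℝ :=
  ∑ x, ((p x).1 * (q x).1 + (p x).2 * (q x).2)

/-- Squared Euclidean norm on `V`. -/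
def normVsq {M N : ℕ} (u : Idx M N → ℝ) : ℝ := ∑ x, (u x) ^ 2

/-- Max (Euclidean-pointwise) norm on `W`. -/
def normWinf {M N : ℕ} (p : Idx M N → ℝ × ℝ) : ℝ :=
  ⨆ x : Idx M N, Real.sqrt ((p x).1 ^ 2 + (p x).2 ^ 2)

/-- The dual ROF energy `F(p) = (1/2)‖div p + α f‖₂²`. -/
def F {M N : ℕ} (α : ℝ) (f : Idx M N → ℝ) (p : Idx M N → ℝ × ℝ) : ℝ :=
  (1 / 2) * normVsq (fun x => divOp p x + α * f x)

/-- The gradient of `F`, namely `∇F(q) = div*(div q + α f) = -∇(div q + α f)`. -/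
def gradF {M N : ℕ} (α : ℝ) (f : Idx M N → ℝ) (q : Idx M N → ℝ × ℝ) :
    Idx M N → ℝ × ℝ :=
  fun x => - gradOp (fun y => divOp q y + α * f y) x

/-- The constraint set `C = {p ∈ W : |p_{ij}| ≤ 1 ∀ (i,j)}`. -/
def Cset (M N : ℕ) : Set (Idx M N → ℝ × ℝ) :=
  {p | ∀ x, Real.sqrt ((p x).1 ^ 2 + (p x).2 ^ 2) ≤ 1}

/-- Restriction operator `R_k : W → W_k`. -/
def Rk {M N : ℕ} (S : Finset (Idx M N)) (p : Idx M N → ℝ × ℝ) :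
    {x // x ∈ S} → ℝ × ℝ :=
  fun x => p x.1

/-- Extension-by-zero operator `R_k* : W_k → W`. -/
def Ek {M N : ℕ} (S : Finset (Idx M N)) (pk : {x // x ∈ S} → ℝ × ℝ) :
    Idx M N → ℝ × ℝ :=
  fun x => if h : x ∈ S then pk ⟨x, h⟩ else 0

/-- The orthogonal projection `R_k* R_k : W → W`. -/
def projk {M N : ℕ} (S : Finset (Idx M N)) (p : Idx M N → ℝ × ℝ) :
    Idx M N → ℝ × ℝ :=
  fun x => if x ∈ S then p x else 0

/-- The local constraint set `C_k = R_k C`. -/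
def Ck {M N : ℕ} (S : Finset (Idx M N)) : Set ({x // x ∈ S} → ℝ × ℝ) :=
  Rk S '' Cset M N

/-- The local energy `F_k(p_k; r) = F(R_k* p_k + (I - R_k* R_k) r)`. -/
def Fk {M N : ℕ} (α : ℝ) (f : Idx M N → ℝ) (S : Finset (Idx M N))
    (pk : {x // x ∈ S} → ℝ × ℝ) (r : Idx M N → ℝ × ℝ) : ℝ :=
  F α f (Ek S pk + (r - projk S r))

/-- Euclidean inner product on `W_k`. -/
def innerWk {M N : ℕ} (S : Finset (Idx M N)) (pk qk : {x // x ∈ S} → ℝ × ℝ) : ℝ :=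
  ∑ x : {x // x ∈ S}, ((pk x).1 * (qk x).1 + (pk x).2 * (qk x).2)

/-- The distance-like quantity `D(p,q) = Σ_k (1/2)‖div R_k* R_k (p - q)‖₂²`. -/
def Ddist {M N Nc : ℕ} (S : Fin Nc → Finset (Idx M N))
    (p q : Idx M N → ℝ × ℝ) : ℝ :=
  ∑ k, (1 / 2) * normVsq (divOp (projk (S k) (p - q)))

/-- The rectangular subdomain `Ω_s` of size `m × n` indexed by `s : Fin Ms × Fin Ns`
(for an `M × N` image with `M = Ms * m`, `N = Ns * n`). -/
def block {M N Ms Ns : ℕ} (m n : ℕ) (s : Fin Ms × Fin Ns) : Finset (Idx M N) :=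
  Finset.univ.filter fun x => (x.1 : ℕ) / m = (s.1 : ℕ) ∧ (x.2 : ℕ) / n = (s.2 : ℕ)

end

/-- Discrete summation by parts in one dimension. -/
theorem sum_mul_backward_diff (n : ℕ) (u a : Fin n → ℝ) :
    ∑ i : Fin n, u i * ((if (i : ℕ) + 1 < n then a i else 0)
      - (if 1 ≤ (i : ℕ) then a ⟨(i : ℕ) - 1, lt_of_le_of_lt (Nat.sub_le _ _) i.isLt⟩ else 0))
    = -∑ i : Fin n, (if h : (i : ℕ) + 1 < n then u ⟨(i : ℕ) + 1, h⟩ - u i else 0) * a i := by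
  rcases n with _ | n
  · simp
  have hshift : ∑ i : Fin (n + 1), u i * (if 1 ≤ (i : ℕ) then
        a ⟨(i : ℕ) - 1, lt_of_le_of_lt (Nat.sub_le _ _) i.isLt⟩ else 0)
      = ∑ i : Fin (n + 1), (if h : (i : ℕ) + 1 < n + 1 then u ⟨(i : ℕ) + 1, h⟩ else 0) * a i := by
    rw [Fin.sum_univ_succ, Fin.sum_univ_castSucc]
    simp
    rfl
  simp only [mul_sub, Finset.sum_sub_distrib]
  rw [hshift, ← Finset.sum_sub_distrib, ← Finset.sum_neg_distrib]
  refine Finset.sum_congr rfl fun i _ => ?_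
  split_ifs <;> ring

/-- The divergence is the negative adjoint of the gradient. -/
theorem innerV_divOp {M N : ℕ} (u : Idx M N → ℝ) (p : Idx M N → ℝ × ℝ) :
    innerV u (divOp p) = -innerW (gradOp u) p := by
  simp only [innerV, innerW, divOp, gradOp, mul_add, Finset.sum_add_distrib, neg_add]
  congr 1
  · rw [Fintype.sum_prod_type_right, Fintype.sum_prod_type_right, ← Finset.sum_neg_distrib]
    exact Finset.sum_congr rfl fun j _ =>
      sum_mul_backward_diff M (fun i => u (i, j)) (fun i => (p (i, j)).1)
  · rw [Fintype.sum_prod_type, Fintype.sum_prod_type, ← Finset.sum_neg_distrib]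
    exact Finset.sum_congr rfl fun i _ =>
      sum_mul_backward_diff N (fun j => u (i, j)) (fun j => (p (i, j)).2)

theorem divOp_sub {M N : ℕ} (p q : Idx M N → ℝ × ℝ) :
    divOp (p - q) = divOp p - divOp q := by
  funext x
  simp only [divOp, Pi.sub_apply, Prod.fst_sub, Prod.snd_sub]
  split_ifs <;> ring

theorem divOp_sum {M N : ℕ} {ι : Type*} (s : Finset ι) (g : ι → Idx M N → ℝ × ℝ) :
    divOp (∑ k ∈ s, g k) = ∑ k ∈ s, divOp (g k) := by
  funext x
  simp only [divOp, Finset.sum_apply, Prod.fst_sum, Prod.snd_sum, Finset.sum_add_distrib,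
    Finset.sum_sub_distrib]
  split_ifs <;> simp

/-- The block projections of a partition sum to the identity. -/
theorem sum_projk {M N Nc : ℕ} (S : Fin Nc → Finset (Idx M N))
    (hdisj : ∀ k l, k ≠ l → Disjoint (S k) (S l))
    (hcover : ∀ x : Idx M N, ∃ k, x ∈ S k) (p : Idx M N → ℝ × ℝ) :
    ∑ k, projk (S k) p = p := by
  funext x
  obtain ⟨k, hk⟩ := hcover x
  rw [Finset.sum_apply, Finset.sum_eq_single k]
  · simp [projk, hk]
  · intro l _ hl
    simp [projk, Finset.disjoint_left.mp (hdisj k l hl.symm) hk]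
  · simp

theorem normVsq_sum_le {M N Nc : ℕ} (g : Fin Nc → Idx M N → ℝ) :
    normVsq (∑ k, g k) ≤ (Nc : ℝ) * ∑ k, normVsq (g k) := by
  simp only [normVsq, Finset.sum_apply]
  rw [Finset.sum_comm, Finset.mul_sum]
  refine Finset.sum_le_sum fun x _ => ?_
  simpa using sq_sum_le_card_mul_sum_sq (s := Finset.univ) (f := fun k => g k x)

/-- The exact second-order expansion of the quadratic energy `F`. -/
theorem F_eq_add {M N : ℕ} (α : ℝ) (f : Idx M N → ℝ) (p q : Idx M N → ℝ × ℝ) :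
    F α f p = F α f q + innerW (gradF α f q) (p - q)
      + (1 / 2) * normVsq (divOp (p - q)) := by
  have hgrad : innerW (gradF α f q) (p - q)
      = innerV (fun y => divOp q y + α * f y) (divOp (p - q)) := by
    rw [innerV_divOp]
    simp only [innerW, gradF, Prod.fst_neg, Prod.snd_neg]
    rw [← Finset.sum_neg_distrib]
    exact Finset.sum_congr rfl fun x _ => by ring
  rw [hgrad, divOp_sub]
  simp only [F, normVsq, innerV, Pi.sub_apply, Finset.mul_sum, ← Finset.sum_add_distrib]
  exact Finset.sum_congr rfl fun x _ => by ring

theorem descent_lemma (M N : ℕ) (α : ℝ) (hα : 0 < α) (f : Idx M N → ℝ)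
    (Nc : ℕ) (S : Fin Nc → Finset (Idx M N))
    (hdisj : ∀ k l, k ≠ l → Disjoint (S k) (S l))
    (hcover : ∀ x : Idx M N, ∃ k, x ∈ S k)
    (p q : Idx M N → ℝ × ℝ) :
    F α f p ≤ F α f q + innerW (gradF α f q) (p - q) + (Nc : ℝ) * Ddist S p q := by
  have hdecomp : normVsq (divOp (p - q))
      ≤ (Nc : ℝ) * ∑ k, normVsq (divOp (projk (S k) (p - q))) := by
    conv_lhs => rw [← sum_projk S hdisj hcover (p - q), divOp_sum]
    exact normVsq_sum_le _
  rw [F_eq_add α f p q, Ddist, ← Finset.mul_sum]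
  linarith
end

section
/- Optimality of the local solution operator: for any p_k ∈ C_k and q ∈ C, if s_k ∈ C_k minimizes F_k(·; q) over C_k and S̄_k(q) = R_k* s_k + (I − R_k* R_k) q, then F_k(p_k; q) − F(S̄_k(q)) ≥ (1/2)‖div R_k*(p_k − R_k S̄_k(q))‖₂². -/
open Finset

theorem divOp_add_smul {M N : ℕ} (p d : Idx M N → ℝ × ℝ) (t : ℝ) (x : Idx M N) :
    divOp (p + t • d) x = divOp p x + t * divOp d x := by
  simp only [divOp, Pi.add_apply, Pi.smul_apply, Prod.fst_add, Prod.snd_add, Prod.smul_fst,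
    Prod.smul_snd, smul_eq_mul]
  split_ifs <;> ring

theorem F_add_smul {M N : ℕ} (α : ℝ) (f : Idx M N → ℝ) (p d : Idx M N → ℝ × ℝ) (t : ℝ) :
    F α f (p + t • d) = F α f p + t * innerV (fun x => divOp p x + α * f x) (divOp d)
      + t ^ 2 * ((1 / 2) * normVsq (divOp d)) := by
  simp only [F, normVsq, innerV, divOp_add_smul, Finset.mul_sum, ← Finset.sum_add_distrib]
  exact Finset.sum_congr rfl fun x _ => by ring

theorem convex_Cset (M N : ℕ) : Convex ℝ (Cset M N) := by
  intro p hp q hq a b ha hb hab x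
  have h₁ := hp x
  have h₂ := hq x
  rw [Real.sqrt_le_one] at h₁ h₂ ⊢
  simp only [Pi.add_apply, Pi.smul_apply, Prod.fst_add, Prod.snd_add, Prod.smul_fst,
    Prod.smul_snd, smul_eq_mul]
  obtain rfl : b = 1 - a := by linarith
  nlinarith [mul_le_mul_of_nonneg_left h₁ ha, mul_le_mul_of_nonneg_left h₂ hb,
    mul_nonneg (mul_nonneg ha hb) (add_nonneg (sq_nonneg ((p x).1 - (q x).1))
      (sq_nonneg ((p x).2 - (q x).2)))]

theorem convex_Ck {M N : ℕ} (S : Finset (Idx M N)) : Convex ℝ (Ck S) := by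
  rintro _ ⟨p, hp, rfl⟩ _ ⟨q, hq, rfl⟩ a b ha hb hab
  exact ⟨a • p + b • q, convex_Cset M N hp hq ha hb hab, rfl⟩

theorem Ek_add_smul {M N : ℕ} (S : Finset (Idx M N)) (p d : {x // x ∈ S} → ℝ × ℝ) (t : ℝ) :
    Ek S (p + t • d) = Ek S p + t • Ek S d := by
  funext x
  by_cases h : x ∈ S <;> simp [Ek, h]

theorem Rk_Ek_add_compl {M N : ℕ} (S : Finset (Idx M N)) (p : {x // x ∈ S} → ℝ × ℝ)
    (q : Idx M N → ℝ × ℝ) : Rk S (Ek S p + (q - projk S q)) = p := by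
  funext x
  simp [Rk, Ek, projk]

theorem Fk_add_smul {M N : ℕ} (α : ℝ) (f : Idx M N → ℝ) (S : Finset (Idx M N))
    (p d : {x // x ∈ S} → ℝ × ℝ) (q : Idx M N → ℝ × ℝ) (t : ℝ) :
    Fk α f S (p + t • d) q = Fk α f S p q
      + t * innerV (fun x => divOp (Ek S p + (q - projk S q)) x + α * f x) (divOp (Ek S d))
      + t ^ 2 * ((1 / 2) * normVsq (divOp (Ek S d))) := by
  rw [Fk, Ek_add_smul, add_right_comm, F_add_smul, Fk]

/-- A quadratic `t * b + t ^ 2 * c` that is nonnegative on `(0, 1]` has `b ≥ 0`. -/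
theorem nonneg_of_forall_mul_add_sq_mul_nonneg {b c : ℝ}
    (h : ∀ t : ℝ, 0 < t → t ≤ 1 → 0 ≤ t * b + t ^ 2 * c) : 0 ≤ b := by
  by_contra! hb
  have hc : 0 < c := by linarith [h 1 one_pos le_rfl]
  have hbc : b + c ≥ 0 := by linarith [h 1 one_pos le_rfl]
  have ht : 0 < -b / (2 * c) := div_pos (by linarith) (by linarith)
  have key := h _ ht ((div_le_one (by linarith)).2 (by linarith))
  have heq : -b / (2 * c) * b + (-b / (2 * c)) ^ 2 * c = -b / (2 * c) * (b / 2) := by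
    field_simp
    ring
  rw [heq] at key
  exact absurd key (not_le.2 (mul_neg_of_pos_of_neg ht (by linarith)))

theorem local_optimality (M N : ℕ) (α : ℝ) (hα : 0 < α) (f : Idx M N → ℝ)
    (Nc : ℕ) (S : Fin Nc → Finset (Idx M N))
    (hdisj : ∀ k l, k ≠ l → Disjoint (S k) (S l))
    (hcover : ∀ x : Idx M N, ∃ k, x ∈ S k)
    (k : Fin Nc) (q : Idx M N → ℝ × ℝ) (hq : q ∈ Cset M N)
    (pk : {x // x ∈ S k} → ℝ × ℝ) (hpk : pk ∈ Ck (S k))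
    (sk : {x // x ∈ S k} → ℝ × ℝ) (hsk : sk ∈ Ck (S k))
    (hmin : ∀ rk ∈ Ck (S k), Fk α f (S k) sk q ≤ Fk α f (S k) rk q) :
    Fk α f (S k) pk q - F α f (Ek (S k) sk + (q - projk (S k) q))
      ≥ (1 / 2) * normVsq (divOp (Ek (S k)
          (pk - Rk (S k) (Ek (S k) sk + (q - projk (S k) q))))) := by
  rw [Rk_Ek_add_compl]
  have hquad := Fk_add_smul α f (S k) sk (pk - sk) q
  have hinner := nonneg_of_forall_mul_add_sq_mul_nonneg fun t ht₀ ht₁ => by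
    have hle := hmin _ ((convex_Ck (S k)).add_smul_sub_mem hsk hpk ⟨ht₀.le, ht₁⟩)
    rw [hquad t, add_assoc] at hle
    exact le_add_iff_nonneg_right _ |>.1 hle
  have hone := hquad 1
  rw [one_smul, add_sub_cancel, one_mul, one_pow, one_mul] at hone
  rw [hone]
  simp only [Fk] at hinner ⊢
  linarith
end

section
/- Per-subdomain divergence truncation bound: assume Ω with M × N pixels is partitioned into N_d = M_s × N_s nonoverlapping rectangular subdomains {Ω_s} of equal size (M/M_s) × (N/N_s). For each subdomain Ω_s, with R^s: W → W^s the restriction to Ω_s and (R^s)* extension by zero, every p ∈ W satisfies ‖div (R^s)* R^s p‖₂² − ‖(div p)|_{Ω_s}‖₂² ≤ 7(M/M_s + N/N_s − 11/7)‖p‖∞². -/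
open Finset

/-- The indicator function of the integer interval `[l, r)`. -/
noncomputable def icoInd (l r i : ℕ) : ℝ := if l ≤ i ∧ i < r then 1 else 0

lemma icoInd_mul_icoInd (l r l' r' i j : ℕ) :
    icoInd l r i * icoInd l' r' j =
      if (l ≤ i ∧ i < r) ∧ (l' ≤ j ∧ j < r') then 1 else 0 := by
  simp only [icoInd, ite_and]
  split_ifs <;> simp

lemma sum_icoInd_le {l r : ℕ} (M : ℕ) (h : l ≤ r) :
    ∑ i : Fin M, icoInd l r i ≤ (r : ℝ) - l := by
  rw [Fin.sum_univ_eq_sum_range (icoInd l r)]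
  simp only [icoInd, sum_boole]
  have hsub : ((range M).filter fun i => l ≤ i ∧ i < r) ⊆ Ico l r := by
    intro i hi
    simpa using (mem_filter.mp hi).2
  have hcard := card_le_card hsub
  rw [Nat.card_Ico] at hcard
  rw [← Nat.cast_sub h]
  exact_mod_cast hcard

lemma sum_icoInd_eq {l r M : ℕ} (h : l ≤ r) (hr : r ≤ M) :
    ∑ i : Fin M, icoInd l r i = (r : ℝ) - l := by
  rw [Fin.sum_univ_eq_sum_range (icoInd l r)]
  simp only [icoInd, sum_boole]
  have heq : ((range M).filter fun i => l ≤ i ∧ i < r) = Ico l r := by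
    ext i
    simp only [mem_filter, mem_range, mem_Ico]
    omega
  rw [heq, Nat.card_Ico, Nat.cast_sub h]

lemma sum_mul_idx {M N : ℕ} (f g : ℕ → ℝ) :
    ∑ x : Idx M N, f x.1 * g x.2 = (∑ i : Fin M, f i) * ∑ j : Fin N, g j := by
  rw [Fintype.sum_mul_sum, Fintype.sum_prod_type]

lemma sq_add_sq_le_normWinf_sq {M N : ℕ} (p : Idx M N → ℝ × ℝ) (x : Idx M N) :
    (p x).1 ^ 2 + (p x).2 ^ 2 ≤ normWinf p ^ 2 := by
  have h : Real.sqrt ((p x).1 ^ 2 + (p x).2 ^ 2) ≤ normWinf p :=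
    le_ciSup (f := fun x : Idx M N => Real.sqrt ((p x).1 ^ 2 + (p x).2 ^ 2))
      (Set.finite_range _).bddAbove x
  have h0 : 0 ≤ (p x).1 ^ 2 + (p x).2 ^ 2 := by positivity
  calc (p x).1 ^ 2 + (p x).2 ^ 2
      = Real.sqrt ((p x).1 ^ 2 + (p x).2 ^ 2) ^ 2 := (Real.sq_sqrt h0).symm
    _ ≤ normWinf p ^ 2 := pow_le_pow_left₀ (Real.sqrt_nonneg _) h 2

lemma mem_block_iff {M N Ms Ns m n : ℕ} (hm : 0 < m) (hn : 0 < n)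
    (s : Fin Ms × Fin Ns) (x : Idx M N) :
    x ∈ (block m n s : Finset (Idx M N)) ↔
      ((s.1 : ℕ) * m ≤ x.1 ∧ (x.1 : ℕ) < s.1 * m + m) ∧
        ((s.2 : ℕ) * n ≤ x.2 ∧ (x.2 : ℕ) < s.2 * n + n) := by
  have key : ∀ i k t : ℕ, 0 < k → (i / k = t ↔ t * k ≤ i ∧ i < t * k + k) := by
    intro i k t hk
    rw [Nat.div_eq_iff hk]
    omega
  simp [block, key _ _ _ hm, key _ _ _ hn]

/-- Off the corner, dropping one neighbour's contribution costs at most `6 K²`. -/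
lemma sq_sub_sq_le_of_drop_one {a b c d K : ℝ} (hab : a ^ 2 + b ^ 2 ≤ K ^ 2)
    (hc : c ^ 2 ≤ K ^ 2) (hd : d ^ 2 ≤ K ^ 2) :
    (a + (b - d)) ^ 2 - ((a - c) + (b - d)) ^ 2 ≤ 6 * K ^ 2 := by
  nlinarith [sq_nonneg (a - c), sq_nonneg (b - c), sq_nonneg (d + c), sq_nonneg c]

/-- At the corner, dropping both neighbours' contributions costs at most `2 K²`. -/
lemma sq_sub_sq_le_of_drop_two {a b c d K : ℝ} (hab : a ^ 2 + b ^ 2 ≤ K ^ 2) :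
    (a + b) ^ 2 - ((a - c) + (b - d)) ^ 2 ≤ 2 * K ^ 2 := by
  nlinarith [sq_nonneg (a - b), sq_nonneg ((a - c) + (b - d))]

/-- The pointwise contribution to the truncation defect is bounded by a combination of
indicators of the edges of a rectangle `[a, a + m) × [c, c + n)` and of its outer neighbours. -/
lemma pointwise_divergence_bound {M N a c m n : ℕ} (hm : 0 < m) (hn : 0 < n)
    (S : Finset (Idx M N))
    (hS : ∀ x, x ∈ S ↔ (a ≤ x.1 ∧ (x.1 : ℕ) < a + m) ∧ (c ≤ x.2 ∧ (x.2 : ℕ) < c + n))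
    (p : Idx M N → ℝ × ℝ) {K : ℝ} (hK : ∀ x, (p x).1 ^ 2 + (p x).2 ^ 2 ≤ K ^ 2)
    (z : Idx M N) (hz₁ : (z.1 : ℕ) + 1 = a + m) (hz₂ : (z.2 : ℕ) + 1 = c + n)
    (x : Idx M N) :
    divOp (projk S p) x ^ 2 - (if x ∈ S then divOp p x ^ 2 else 0) ≤
      6 * K ^ 2 * (icoInd a (a + 1) x.1 * icoInd c (c + n) x.2)
      + 6 * K ^ 2 * (icoInd a (a + m) x.1 * icoInd c (c + 1) x.2)
      - 10 * K ^ 2 * (icoInd a (a + 1) x.1 * icoInd c (c + 1) x.2)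
      + K ^ 2 * (icoInd (a + m) (a + m + 1) x.1 * icoInd c (c + n - 1) x.2)
      + K ^ 2 * (icoInd a (a + m - 1) x.1 * icoInd (c + n) (c + n + 1) x.2)
      + (p z).1 ^ 2 * (icoInd (a + m) (a + m + 1) x.1 * icoInd (c + n - 1) (c + n) x.2)
      + (p z).2 ^ 2 * (icoInd (a + m - 1) (a + m) x.1 * icoInd (c + n) (c + n + 1) x.2) := by
  have hself := hK x
  have hK0 : 0 ≤ K ^ 2 := sq_nonneg K
  obtain ⟨⟨i, hi⟩, ⟨j, hj⟩⟩ := x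
  obtain ⟨⟨z₁, hz1⟩, ⟨z₂, hz2⟩⟩ := z
  simp only at hz₁ hz₂
  have hleft := hK (⟨i - 1, by omega⟩, ⟨j, hj⟩)
  have hdown := hK (⟨i, hi⟩, ⟨j - 1, by omega⟩)
  have hleft_eq : i = a + m → j + 1 = c + n → p (⟨i - 1, by omega⟩, ⟨j, hj⟩) =
      p (⟨z₁, hz1⟩, ⟨z₂, hz2⟩) := by
    intro h h'
    congr 3 <;> omega
  have hdown_eq : j = c + n → i + 1 = a + m → p (⟨i, hi⟩, ⟨j - 1, by omega⟩) =
      p (⟨z₁, hz1⟩, ⟨z₂, hz2⟩) := by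
    intro h h'
    congr 3 <;> omega
  obtain ⟨A₁, hA₁⟩ : ∃ t, t = if i + 1 < M then (p (⟨i, hi⟩, ⟨j, hj⟩)).1 else 0 := ⟨_, rfl⟩
  obtain ⟨A₂, hA₂⟩ : ∃ t, t = if j + 1 < N then (p (⟨i, hi⟩, ⟨j, hj⟩)).2 else 0 := ⟨_, rfl⟩
  obtain ⟨B₁, hB₁⟩ : ∃ t, t = if 1 ≤ i then (p (⟨i - 1, by omega⟩, ⟨j, hj⟩)).1 else 0 :=
    ⟨_, rfl⟩
  obtain ⟨B₂, hB₂⟩ : ∃ t, t = if 1 ≤ j then (p (⟨i, hi⟩, ⟨j - 1, by omega⟩)).2 else 0 :=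
    ⟨_, rfl⟩
  have hdiv : divOp p (⟨i, hi⟩, ⟨j, hj⟩) = (A₁ - B₁) + (A₂ - B₂) := by
    simp only [divOp, hA₁, hA₂, hB₁, hB₂]
  have hdivq : divOp (projk S p) (⟨i, hi⟩, ⟨j, hj⟩) =
      ((if (a ≤ i ∧ i < a + m) ∧ (c ≤ j ∧ j < c + n) then A₁ else 0)
        - (if (a + 1 ≤ i ∧ i < a + m + 1) ∧ (c ≤ j ∧ j < c + n) then B₁ else 0))
      + ((if (a ≤ i ∧ i < a + m) ∧ (c ≤ j ∧ j < c + n) then A₂ else 0)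
        - (if (a ≤ i ∧ i < a + m) ∧ (c + 1 ≤ j ∧ j < c + n + 1) then B₂ else 0)) := by
    simp only [divOp, projk, hS, hA₁, hA₂, hB₁, hB₂]
    congr 2
    · split_ifs <;> simp
    · split_ifs <;> first | rfl | omega
    · split_ifs <;> simp
    · split_ifs <;> first | rfl | omega
  have hA : A₁ ^ 2 + A₂ ^ 2 ≤ K ^ 2 := by
    rw [hA₁, hA₂]
    split_ifs <;> nlinarith [sq_nonneg (p (⟨i, hi⟩, ⟨j, hj⟩)).1,
      sq_nonneg (p (⟨i, hi⟩, ⟨j, hj⟩)).2]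
  have hB₁K : B₁ ^ 2 ≤ K ^ 2 := by
    rw [hB₁]
    split_ifs <;> nlinarith [sq_nonneg (p (⟨i - 1, by omega⟩, ⟨j, hj⟩)).2]
  have hB₂K : B₂ ^ 2 ≤ K ^ 2 := by
    rw [hB₂]
    split_ifs <;> nlinarith [sq_nonneg (p (⟨i, hi⟩, ⟨j - 1, by omega⟩)).1]
  have hB₁z : i = a + m → j + 1 = c + n → B₁ = (p (⟨z₁, hz1⟩, ⟨z₂, hz2⟩)).1 := by
    intro h h'
    rw [hB₁, if_pos (by omega), hleft_eq h h']
  have hB₂z : j = c + n → i + 1 = a + m → B₂ = (p (⟨z₁, hz1⟩, ⟨z₂, hz2⟩)).2 := by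
    intro h h'
    rw [hB₂, if_pos (by omega), hdown_eq h h']
  rw [hdiv, hdivq]
  simp only [hS, icoInd_mul_icoInd]
  clear hA₁ hA₂ hB₁ hB₂ hdiv hdivq hleft_eq hdown_eq hself hleft hdown hS hK
  by_cases hin : (a ≤ i ∧ i < a + m) ∧ (c ≤ j ∧ j < c + n)
  · rcases eq_or_lt_of_le hin.1.1 with hi' | hi' <;> rcases eq_or_lt_of_le hin.2.1 with hj' | hj'
    · simp (disch := omega) only [if_pos, if_neg]
      linarith [sq_sub_sq_le_of_drop_two (c := B₁) (d := B₂) hA]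
    · simp (disch := omega) only [if_pos, if_neg]
      linarith [sq_sub_sq_le_of_drop_one hA hB₁K hB₂K]
    · simp (disch := omega) only [if_pos, if_neg]
      linarith [sq_sub_sq_le_of_drop_one ((add_comm _ _).trans_le hA) hB₂K hB₁K]
    · simp (disch := omega) only [if_pos, if_neg]
      linarith
  · by_cases hright : i = a + m ∧ (c ≤ j ∧ j < c + n)
    · by_cases hlast : j + 1 = c + n
      · simp (disch := omega) only [if_pos, if_neg]
        rw [hB₁z hright.1 hlast]
        linarith
      · simp (disch := omega) only [if_pos, if_neg]
        linarith
    · by_cases htop : j = c + n ∧ (a ≤ i ∧ i < a + m)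
      · by_cases hlast : i + 1 = a + m
        · simp (disch := omega) only [if_pos, if_neg]
          rw [hB₂z htop.1 hlast]
          linarith
        · simp (disch := omega) only [if_pos, if_neg]
          linarith
      · simp (disch := omega) only [if_neg]
        linarith

theorem per_subdomain_divergence_bound (M N Ms Ns m n : ℕ) (hm : 0 < m) (hn : 0 < n)
    (hM : M = Ms * m) (hN : N = Ns * n)
    (s : Fin Ms × Fin Ns) (p : Idx M N → ℝ × ℝ) :
    normVsq (divOp (projk (block m n s) p))
        - ∑ x ∈ (block m n s : Finset (Idx M N)), (divOp p x) ^ 2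
      ≤ 7 * ((m : ℝ) + (n : ℝ) - 11 / 7) * normWinf p ^ 2 := by
  have hS := mem_block_iff (M := M) (N := N) hm hn s
  have haM : (s.1 : ℕ) * m + m ≤ M := by
    rw [hM, ← Nat.succ_mul]
    exact Nat.mul_le_mul_right m s.1.isLt
  have hcN : (s.2 : ℕ) * n + n ≤ N := by
    rw [hN, ← Nat.succ_mul]
    exact Nat.mul_le_mul_right n s.2.isLt
  generalize (block m n s : Finset (Idx M N)) = S at hS ⊢
  generalize (s.1 : ℕ) * m = a at hS haM
  generalize (s.2 : ℕ) * n = c at hS hcN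
  have hK := sq_add_sq_le_normWinf_sq p
  let z : Idx M N := (⟨a + m - 1, by omega⟩, ⟨c + n - 1, by omega⟩)
  have hz := hK z
  have hsum := sum_le_sum fun x (_ : x ∈ (univ : Finset (Idx M N))) =>
    pointwise_divergence_bound hm hn S hS p hK z
      (by simp only [z]; omega) (by simp only [z]; omega) x
  simp only [sum_add_distrib, sum_sub_distrib, ← mul_sum, sum_mul_idx] at hsum
  rw [← sum_filter, filter_mem_eq_inter, univ_inter] at hsum
  rw [normVsq]
  refine hsum.trans ?_
  have hm1 : ((a + m - 1 : ℕ) : ℝ) = a + m - 1 := by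
    rw [Nat.cast_sub (by omega)]; push_cast; ring
  have hn1 : ((c + n - 1 : ℕ) : ℝ) = c + n - 1 := by
    rw [Nat.cast_sub (by omega)]; push_cast; ring
  rw [sum_icoInd_eq (M := M) (l := a) (r := a + 1) (by omega) (by omega),
    sum_icoInd_eq (M := M) (l := a) (r := a + m) (by omega) (by omega),
    sum_icoInd_eq (M := M) (l := a) (r := a + m - 1) (by omega) (by omega),
    sum_icoInd_eq (M := M) (l := a + m - 1) (r := a + m) (by omega) (by omega),
    sum_icoInd_eq (M := N) (l := c) (r := c + 1) (by omega) (by omega),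
    sum_icoInd_eq (M := N) (l := c) (r := c + n) (by omega) (by omega),
    sum_icoInd_eq (M := N) (l := c) (r := c + n - 1) (by omega) (by omega),
    sum_icoInd_eq (M := N) (l := c + n - 1) (r := c + n) (by omega) (by omega)]
  have hγ := sum_icoInd_le M (Nat.le_succ (a + m))
  have hδ := sum_icoInd_le N (Nat.le_succ (c + n))
  rw [Nat.succ_eq_add_one] at hγ hδ
  rw [hm1, hn1]
  push_cast at hγ hδ ⊢
  generalize ∑ i : Fin M, icoInd (a + m) (a + m + 1) i = γ at hγ ⊢
  generalize ∑ j : Fin N, icoInd (c + n) (c + n + 1) j = δ at hδ ⊢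
  have hγ1 : γ ≤ 1 := by linarith
  have hδ1 : δ ≤ 1 := by linarith
  have hm' : (1 : ℝ) ≤ m := by exact_mod_cast hm
  have hn' : (1 : ℝ) ≤ n := by exact_mod_cast hn
  have e1 := mul_le_mul_of_nonneg_left hγ1
    (mul_nonneg (sq_nonneg (normWinf p)) (sub_nonneg.2 hn'))
  have e2 := mul_le_mul_of_nonneg_left hδ1
    (mul_nonneg (sq_nonneg (normWinf p)) (sub_nonneg.2 hm'))
  have e3 := mul_le_mul_of_nonneg_left hγ1 (sq_nonneg (p z).1)
  have e4 := mul_le_mul_of_nonneg_left hδ1 (sq_nonneg (p z).2)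
  nlinarith
end

section
/- Global divergence truncation bound: assume Ω with M × N pixels is partitioned into N_d = M_s × N_s nonoverlapping rectangular subdomains {Ω_s} of equal size. For any p ∈ W, Σ_{s=1}^{N_d} ‖div (R^s)* R^s p‖₂² ≤ ‖div p‖₂² + c₁ ‖p‖∞², where c₁ = 7(M N_s + M_s N − (11/7) M_s N_s), and R^s: W → W^s denotes restriction to Ω_s with (R^s)* extension by zero. -/
open Finset

/-- The index of the subdomain containing a pixel. -/
def blockIdx {m n Ms Ns : ℕ} (x : Idx (Ms * m) (Ns * n)) : Fin Ms × Fin Ns :=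
  (⟨(x.1 : ℕ) / m, Nat.div_lt_of_lt_mul (by simpa [mul_comm] using x.1.isLt)⟩,
   ⟨(x.2 : ℕ) / n, Nat.div_lt_of_lt_mul (by simpa [mul_comm] using x.2.isLt)⟩)

lemma projk_block_apply {m n Ms Ns : ℕ} (p : Idx (Ms * m) (Ns * n) → ℝ × ℝ)
    (s : Fin Ms × Fin Ns) (x : Idx (Ms * m) (Ns * n)) :
    projk (block m n s) p x = if blockIdx x = s then p x else 0 := by
  have h : x ∈ block m n s ↔ blockIdx x = s := by
    simp [block, blockIdx, Prod.ext_iff, Fin.ext_iff]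
  simp only [projk, h]

/-- The pixel preceding `x` in the first direction (`x` itself at the boundary). -/
def predFst {M N : ℕ} (x : Idx M N) : Idx M N :=
  (⟨(x.1 : ℕ) - 1, lt_of_le_of_lt (Nat.sub_le _ _) x.1.isLt⟩, x.2)

/-- The pixel preceding `x` in the second direction (`x` itself at the boundary). -/
def predSnd {M N : ℕ} (x : Idx M N) : Idx M N :=
  (x.1, ⟨(x.2 : ℕ) - 1, lt_of_le_of_lt (Nat.sub_le _ _) x.2.isLt⟩)

/-- The contribution of `p x` to `div p x`. -/
def outflow {M N : ℕ} (p : Idx M N → ℝ × ℝ) (x : Idx M N) : ℝ :=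
  (if (x.1 : ℕ) + 1 < M then (p x).1 else 0) + (if (x.2 : ℕ) + 1 < N then (p x).2 else 0)

/-- The contribution of the preceding pixel in the first direction to `div p x`. -/
def inflowFst {M N : ℕ} (p : Idx M N → ℝ × ℝ) (x : Idx M N) : ℝ :=
  if 1 ≤ (x.1 : ℕ) then (p (predFst x)).1 else 0

/-- The contribution of the preceding pixel in the second direction to `div p x`. -/
def inflowSnd {M N : ℕ} (p : Idx M N → ℝ × ℝ) (x : Idx M N) : ℝ :=
  if 1 ≤ (x.2 : ℕ) then (p (predSnd x)).2 else 0

lemma divOp_eq {M N : ℕ} (p : Idx M N → ℝ × ℝ) (x : Idx M N) :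
    divOp p x = outflow p x - inflowFst p x - inflowSnd p x := by
  simp only [divOp, outflow, inflowFst, inflowSnd, predFst, predSnd]
  ring

lemma divOp_projk_block {m n Ms Ns : ℕ} (p : Idx (Ms * m) (Ns * n) → ℝ × ℝ)
    (s : Fin Ms × Fin Ns) (x : Idx (Ms * m) (Ns * n)) :
    divOp (projk (block m n s) p) x =
      (if blockIdx x = s then outflow p x else 0)
      - (if blockIdx (predFst x) = s then inflowFst p x else 0)
      - (if blockIdx (predSnd x) = s then inflowSnd p x else 0) := by
  rw [divOp_eq]
  simp only [outflow, inflowFst, inflowSnd, projk_block_apply]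
  congr 1
  · congr 1
    · split_ifs <;> simp
    · split_ifs <;> simp
  · split_ifs <;> simp

lemma sum_sq_ite_sub {ι : Type*} [Fintype ι] [DecidableEq ι] (u v w : ι) (a b d : ℝ) :
    ∑ s, ((if u = s then a else 0) - (if v = s then b else 0) - (if w = s then d else 0)) ^ 2
      = a ^ 2 + b ^ 2 + d ^ 2 - 2 * a * (if u = v then b else 0)
        - 2 * a * (if u = w then d else 0) + 2 * d * (if v = w then b else 0) := by
  have h : ∀ s, ((if u = s then a else 0) - (if v = s then b else 0)
      - (if w = s then d else 0)) ^ 2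
      = (if u = s then a ^ 2 else 0) + (if v = s then b ^ 2 else 0) + (if w = s then d ^ 2 else 0)
        - (if v = s then 2 * a * (if u = s then b else 0) else 0)
        - (if w = s then 2 * a * (if u = s then d else 0) else 0)
        + (if w = s then 2 * d * (if v = s then b else 0) else 0) := by
    intro s
    split_ifs <;> ring
  simp only [h, sum_add_distrib, sum_sub_distrib, sum_ite_eq, mem_univ, if_true]

lemma sum_sq_divOp_projk_block {m n Ms Ns : ℕ} (p : Idx (Ms * m) (Ns * n) → ℝ × ℝ)
    (x : Idx (Ms * m) (Ns * n)) :
    ∑ s : Fin Ms × Fin Ns, divOp (projk (block m n s) p) x ^ 2 =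
      outflow p x ^ 2 + inflowFst p x ^ 2 + inflowSnd p x ^ 2
      - 2 * outflow p x * (if blockIdx x = blockIdx (predFst x) then inflowFst p x else 0)
      - 2 * outflow p x * (if blockIdx x = blockIdx (predSnd x) then inflowSnd p x else 0)
      + 2 * inflowSnd p x *
        (if blockIdx (predFst x) = blockIdx (predSnd x) then inflowFst p x else 0) := by
  simp only [divOp_projk_block, sum_sq_ite_sub]

lemma pred_div_ne_of_dvd {m i : ℕ} (hm : 0 < m) (hi : 1 ≤ i) (h : m ∣ i) :
    i / m ≠ (i - 1) / m := by
  obtain ⟨k, rfl⟩ := h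
  rw [Nat.mul_div_cancel_left _ hm]
  refine (Nat.div_lt_of_lt_mul ?_).ne'
  omega

lemma pred_div_eq_of_not_dvd {m i : ℕ} (h : ¬ m ∣ i) : i / m = (i - 1) / m := by
  obtain _ | k := i
  · rfl
  · rw [Nat.add_sub_cancel, Nat.succ_div_of_not_dvd h]

lemma sum_sq_divOp_projk_block_corner {m n Ms Ns : ℕ} (hm : 0 < m) (hn : 0 < n)
    (p : Idx (Ms * m) (Ns * n) → ℝ × ℝ) (x : Idx (Ms * m) (Ns * n))
    (h1 : m ∣ (x.1 : ℕ)) (h2 : n ∣ (x.2 : ℕ)) :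
    ∑ s : Fin Ms × Fin Ns, divOp (projk (block m n s) p) x ^ 2 =
      outflow p x ^ 2 + inflowFst p x ^ 2 + inflowSnd p x ^ 2 := by
  have e1 : (if blockIdx x = blockIdx (predFst x) then inflowFst p x else 0) = 0 := by
    simp only [blockIdx, predFst, inflowFst, Prod.ext_iff, Fin.ext_iff]
    grind [pred_div_ne_of_dvd]
  have e2 : (if blockIdx x = blockIdx (predSnd x) then inflowSnd p x else 0) = 0 := by
    simp only [blockIdx, predSnd, inflowSnd, Prod.ext_iff, Fin.ext_iff]
    grind [pred_div_ne_of_dvd]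
  have e3 : (if blockIdx (predFst x) = blockIdx (predSnd x) then inflowFst p x else 0) = 0 := by
    simp only [blockIdx, predFst, predSnd, inflowFst, Prod.ext_iff, Fin.ext_iff]
    grind [pred_div_ne_of_dvd]
  rw [sum_sq_divOp_projk_block, e1, e2, e3]
  ring

lemma sum_sq_divOp_projk_block_fst {m n Ms Ns : ℕ} (hm : 0 < m)
    (p : Idx (Ms * m) (Ns * n) → ℝ × ℝ) (x : Idx (Ms * m) (Ns * n))
    (h1 : m ∣ (x.1 : ℕ)) (h2 : ¬ n ∣ (x.2 : ℕ)) :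
    ∑ s : Fin Ms × Fin Ns, divOp (projk (block m n s) p) x ^ 2 =
      (outflow p x - inflowSnd p x) ^ 2 + inflowFst p x ^ 2 := by
  have e1 : (if blockIdx x = blockIdx (predFst x) then inflowFst p x else 0) = 0 := by
    simp only [blockIdx, predFst, inflowFst, Prod.ext_iff, Fin.ext_iff]
    grind [pred_div_ne_of_dvd]
  have e2 : blockIdx x = blockIdx (predSnd x) := by
    simp [blockIdx, predSnd, pred_div_eq_of_not_dvd h2]
  have e3 : (if blockIdx (predFst x) = blockIdx x then inflowFst p x else 0) = 0 := by
    simpa only [eq_comm] using e1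
  rw [sum_sq_divOp_projk_block, ← e2, e1, e3]
  simp only [if_true]
  ring

lemma sum_sq_divOp_projk_block_snd {m n Ms Ns : ℕ} (hn : 0 < n)
    (p : Idx (Ms * m) (Ns * n) → ℝ × ℝ) (x : Idx (Ms * m) (Ns * n))
    (h1 : ¬ m ∣ (x.1 : ℕ)) (h2 : n ∣ (x.2 : ℕ)) :
    ∑ s : Fin Ms × Fin Ns, divOp (projk (block m n s) p) x ^ 2 =
      (outflow p x - inflowFst p x) ^ 2 + inflowSnd p x ^ 2 := by
  have e1 : (if blockIdx x = blockIdx (predSnd x) then inflowSnd p x else 0) = 0 := by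
    simp only [blockIdx, predSnd, inflowSnd, Prod.ext_iff, Fin.ext_iff]
    grind [pred_div_ne_of_dvd]
  have e2 : blockIdx x = blockIdx (predFst x) := by
    simp [blockIdx, predFst, pred_div_eq_of_not_dvd h1]
  have e3 : inflowSnd p x * (if blockIdx x = blockIdx (predSnd x) then inflowFst p x else 0)
      = 0 := by
    split_ifs at e1 ⊢ <;> simp [e1]
  rw [sum_sq_divOp_projk_block, ← e2, e1]
  simp only [if_true]
  linear_combination 2 * e3

lemma sum_sq_divOp_projk_block_interior {m n Ms Ns : ℕ}
    (p : Idx (Ms * m) (Ns * n) → ℝ × ℝ) (x : Idx (Ms * m) (Ns * n))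
    (h1 : ¬ m ∣ (x.1 : ℕ)) (h2 : ¬ n ∣ (x.2 : ℕ)) :
    ∑ s : Fin Ms × Fin Ns, divOp (projk (block m n s) p) x ^ 2 = divOp p x ^ 2 := by
  have e1 : blockIdx x = blockIdx (predFst x) := by
    simp [blockIdx, predFst, pred_div_eq_of_not_dvd h1]
  have e2 : blockIdx x = blockIdx (predSnd x) := by
    simp [blockIdx, predSnd, pred_div_eq_of_not_dvd h2]
  rw [sum_sq_divOp_projk_block, ← e1, ← e2, divOp_eq]
  simp only [if_true]
  ring

lemma outflow_sq_le {M N : ℕ} (p : Idx M N → ℝ × ℝ) (x : Idx M N) :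
    outflow p x ^ 2 ≤ 2 * normWinf p ^ 2 := by
  have h := sq_add_sq_le_normWinf_sq p x
  unfold outflow
  split_ifs <;> nlinarith [sq_nonneg ((p x).1 - (p x).2), sq_nonneg (p x).1, sq_nonneg (p x).2]

lemma inflowFst_sq_le {M N : ℕ} (p : Idx M N → ℝ × ℝ) (x : Idx M N) :
    inflowFst p x ^ 2 ≤ normWinf p ^ 2 := by
  have h := sq_add_sq_le_normWinf_sq p (predFst x)
  unfold inflowFst
  split_ifs <;> nlinarith [sq_nonneg (p (predFst x)).2, sq_nonneg (normWinf p)]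

lemma inflowSnd_sq_le {M N : ℕ} (p : Idx M N → ℝ × ℝ) (x : Idx M N) :
    inflowSnd p x ^ 2 ≤ normWinf p ^ 2 := by
  have h := sq_add_sq_le_normWinf_sq p (predSnd x)
  unfold inflowSnd
  split_ifs <;> nlinarith [sq_nonneg (p (predSnd x)).1, sq_nonneg (normWinf p)]

lemma sub_sq_add_sq_le {a b d K : ℝ} (ha : a ^ 2 ≤ 2 * K ^ 2) (hb : b ^ 2 ≤ K ^ 2)
    (hd : d ^ 2 ≤ K ^ 2) : (a - d) ^ 2 + b ^ 2 ≤ (a - b - d) ^ 2 + 6 * K ^ 2 := by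
  nlinarith [sq_nonneg (a - b), sq_nonneg (b + d)]

/-- The pointwise estimate: the excess is supported on the first row and column of each block. -/
lemma sum_sq_divOp_projk_block_le {m n Ms Ns : ℕ} (hm : 0 < m) (hn : 0 < n)
    (p : Idx (Ms * m) (Ns * n) → ℝ × ℝ) (x : Idx (Ms * m) (Ns * n)) :
    ∑ s : Fin Ms × Fin Ns, divOp (projk (block m n s) p) x ^ 2 ≤
      divOp p x ^ 2 + (6 * (if m ∣ (x.1 : ℕ) then 1 else 0) + 6 * (if n ∣ (x.2 : ℕ) then 1 else 0)
        - 8 * ((if m ∣ (x.1 : ℕ) then 1 else 0) * (if n ∣ (x.2 : ℕ) then 1 else 0)))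
        * normWinf p ^ 2 := by
  have ha := outflow_sq_le p x
  have hb := inflowFst_sq_le p x
  have hd := inflowSnd_sq_le p x
  by_cases h1 : m ∣ (x.1 : ℕ) <;> by_cases h2 : n ∣ (x.2 : ℕ)
  · rw [sum_sq_divOp_projk_block_corner hm hn p x h1 h2]
    simp only [h1, h2, if_true]
    linarith [sq_nonneg (divOp p x)]
  · rw [sum_sq_divOp_projk_block_fst hm p x h1 h2, divOp_eq]
    simp only [h1, h2, if_true, if_false]
    linarith [sub_sq_add_sq_le ha hb hd]
  · rw [sum_sq_divOp_projk_block_snd hn p x h1 h2, divOp_eq, sub_right_comm]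
    simp only [h1, h2, if_true, if_false]
    linarith [sub_sq_add_sq_le ha hd hb]
  · rw [sum_sq_divOp_projk_block_interior p x h1 h2]
    simp [h1, h2]

lemma sum_fin_dvd_indicator {m : ℕ} (hm : 0 < m) (k : ℕ) :
    ∑ i : Fin (k * m), (if m ∣ (i : ℕ) then (1 : ℝ) else 0) = k := by
  rw [Fin.sum_univ_eq_sum_range (fun i => if m ∣ i then (1 : ℝ) else 0)]
  induction k with
  | zero => simp
  | succ k ih =>
    rw [Nat.succ_mul, sum_range_add, ih, sum_eq_single 0]
    · simp
    · intro b hb hb0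
      rw [if_neg]
      rw [Nat.dvd_add_right (Dvd.intro_left k rfl)]
      exact Nat.not_dvd_of_pos_of_lt (Nat.pos_of_ne_zero hb0) (mem_range.mp hb)
    · simp [hm.ne']

lemma sum_fin_shift_le {M : ℕ} (f : Fin M → ℝ) (hf : ∀ i, 0 ≤ f i) :
    ∑ i : Fin M, (if 1 ≤ (i : ℕ) then
      f ⟨(i : ℕ) - 1, lt_of_le_of_lt (Nat.sub_le _ _) i.isLt⟩ else 0) ≤ ∑ i, f i := by
  cases M with
  | zero => simp
  | succ k =>
    rw [Fin.sum_univ_succ, Fin.sum_univ_castSucc f]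
    simp only [Fin.val_zero, Fin.val_succ, Nat.add_sub_cancel]
    have := hf (Fin.last k)
    simpa [Fin.castSucc, Fin.castAdd, Fin.castLE] using this

lemma sum_inflowFst_sq_le {M N : ℕ} (p : Idx M N → ℝ × ℝ) :
    ∑ x, inflowFst p x ^ 2 ≤ ∑ x, (p x).1 ^ 2 := by
  rw [Fintype.sum_prod_type_right, Fintype.sum_prod_type_right]
  refine sum_le_sum fun j _ => ?_
  simpa [inflowFst, predFst, ite_pow] using
    sum_fin_shift_le (fun i => (p (i, j)).1 ^ 2) fun i => sq_nonneg _

lemma sum_inflowSnd_sq_le {M N : ℕ} (p : Idx M N → ℝ × ℝ) :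
    ∑ x, inflowSnd p x ^ 2 ≤ ∑ x, (p x).2 ^ 2 := by
  rw [Fintype.sum_prod_type, Fintype.sum_prod_type]
  refine sum_le_sum fun i _ => ?_
  simpa [inflowSnd, predSnd, ite_pow] using
    sum_fin_shift_le (fun j => (p (i, j)).2 ^ 2) fun j => sq_nonneg _

/-- The estimate for single-pixel subdomains. -/
lemma sum_normVsq_divOp_projk_pixel_le {Ms Ns : ℕ} (p : Idx (Ms * 1) (Ns * 1) → ℝ × ℝ) :
    ∑ s : Fin Ms × Fin Ns, normVsq (divOp (projk (block 1 1 s) p))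
      ≤ 3 * ((Ms : ℝ) * Ns) * normWinf p ^ 2 := by
  simp only [normVsq]
  rw [sum_comm]
  calc ∑ x, ∑ s : Fin Ms × Fin Ns, divOp (projk (block 1 1 s) p) x ^ 2
      = ∑ x, (outflow p x ^ 2 + inflowFst p x ^ 2 + inflowSnd p x ^ 2) :=
        sum_congr rfl fun x _ => sum_sq_divOp_projk_block_corner one_pos one_pos p x
          (one_dvd _) (one_dvd _)
    _ ≤ ∑ x, (outflow p x ^ 2 + (p x).1 ^ 2 + (p x).2 ^ 2) := by
        simp only [sum_add_distrib]
        exact add_le_add (add_le_add le_rfl (sum_inflowFst_sq_le p)) (sum_inflowSnd_sq_le p)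
    _ ≤ ∑ _x : Idx (Ms * 1) (Ns * 1), 3 * normWinf p ^ 2 :=
        sum_le_sum fun x _ => by linarith [outflow_sq_le p x, sq_add_sq_le_normWinf_sq p x]
    _ = 3 * ((Ms : ℝ) * Ns) * normWinf p ^ 2 := by
        simp
        ring

/-- The estimate obtained by summing the pointwise one. -/
lemma sum_normVsq_divOp_projk_block_le {m n Ms Ns : ℕ} (hm : 0 < m) (hn : 0 < n)
    (p : Idx (Ms * m) (Ns * n) → ℝ × ℝ) :
    ∑ s : Fin Ms × Fin Ns, normVsq (divOp (projk (block m n s) p))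
      ≤ normVsq (divOp p) + (6 * ((Ms : ℝ) * (Ns * n)) + 6 * ((Ms * m) * Ns) - 8 * (Ms * Ns))
        * normWinf p ^ 2 := by
  simp only [normVsq]
  rw [sum_comm]
  refine (sum_le_sum fun x _ => sum_sq_divOp_projk_block_le hm hn p x).trans_eq ?_
  rw [sum_add_distrib, ← sum_mul, sum_sub_distrib, sum_add_distrib, ← mul_sum, ← mul_sum, ← mul_sum]
  have e1 : ∑ x : Idx (Ms * m) (Ns * n), (if m ∣ (x.1 : ℕ) then (1 : ℝ) else 0)
      = Ms * (Ns * n) := by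
    rw [Fintype.sum_prod_type_right]
    simp only [sum_fin_dvd_indicator hm, sum_const, card_univ, Fintype.card_fin, nsmul_eq_mul]
    push_cast
    ring
  have e2 : ∑ x : Idx (Ms * m) (Ns * n), (if n ∣ (x.2 : ℕ) then (1 : ℝ) else 0)
      = (Ms * m) * Ns := by
    rw [Fintype.sum_prod_type]
    simp only [sum_fin_dvd_indicator hn, sum_const, card_univ, Fintype.card_fin, nsmul_eq_mul]
    push_cast
    ring
  have e3 : ∑ x : Idx (Ms * m) (Ns * n), (if m ∣ (x.1 : ℕ) then (1 : ℝ) else 0) *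
      (if n ∣ (x.2 : ℕ) then (1 : ℝ) else 0) = Ms * Ns := by
    rw [Fintype.sum_prod_type, ← sum_fin_dvd_indicator hm Ms, ← sum_fin_dvd_indicator hn Ns,
      sum_mul_sum]
  rw [e1, e2, e3]

theorem global_divergence_bound (M N Ms Ns m n : ℕ) (hm : 0 < m) (hn : 0 < n)
    (hM : M = Ms * m) (hN : N = Ns * n)
    (p : Idx M N → ℝ × ℝ) :
    ∑ s : Fin Ms × Fin Ns, normVsq (divOp (projk (block m n s) p))
      ≤ normVsq (divOp p) + 7 * ((M : ℝ) * (Ns : ℝ) + (Ms : ℝ) * (N : ℝ) - (11 / 7) * ((Ms : ℝ) * (Ns : ℝ))) * normWinf p ^ 2 := by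
  subst hM hN
  have hK : 0 ≤ (Ms : ℝ) * Ns * normWinf p ^ 2 := by positivity
  by_cases h : m = 1 ∧ n = 1
  · obtain ⟨rfl, rfl⟩ := h
    have hV : 0 ≤ normVsq (divOp p) := sum_nonneg fun _ _ => sq_nonneg _
    refine (sum_normVsq_divOp_projk_pixel_le p).trans ?_
    push_cast
    linarith
  · refine (sum_normVsq_divOp_projk_block_le hm hn p).trans ?_
    have hmn : (3 : ℝ) ≤ m + n := by
      exact_mod_cast (by omega : 3 ≤ m + n)
    push_cast
    linarith [mul_le_mul_of_nonneg_right hmn hK]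
end

section
/- Sharper divergence truncation bound for stripe-shaped decompositions: assume Ω with M × N pixels is partitioned into N_d nonoverlapping vertical stripes {Ω_s} of equal size M × (N/N_d) (i.e., M_s = 1, N_s = N_d). Then for any p ∈ W, Σ_{s=1}^{N_d} ‖div (R^s)* R^s p‖₂² ≤ ‖div p‖₂² + N_d (7M − 5)‖p‖∞², where R^s: W → W^s denotes restriction to Ω_s with (R^s)* extension by zero. -/
open Finset

theorem sqrt_le_normWinf {M N : ℕ} (p : Idx M N → ℝ × ℝ) (x : Idx M N) :
    Real.sqrt ((p x).1 ^ 2 + (p x).2 ^ 2) ≤ normWinf p :=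
  le_ciSup (f := fun x : Idx M N => Real.sqrt ((p x).1 ^ 2 + (p x).2 ^ 2))
    (Set.finite_range _).bddAbove x

theorem abs_fst_le_normWinf {M N : ℕ} (p : Idx M N → ℝ × ℝ) (x : Idx M N) :
    |(p x).1| ≤ normWinf p :=
  (Real.abs_le_sqrt (by nlinarith [sq_nonneg (p x).2])).trans (sqrt_le_normWinf p x)

theorem abs_snd_le_normWinf {M N : ℕ} (p : Idx M N → ℝ × ℝ) (x : Idx M N) :
    |(p x).2| ≤ normWinf p :=
  (Real.abs_le_sqrt (by nlinarith [sq_nonneg (p x).1])).trans (sqrt_le_normWinf p x)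

theorem normWinf_nonneg {M N : ℕ} (p : Idx M N → ℝ × ℝ) : 0 ≤ normWinf p :=
  Real.iSup_nonneg fun _ => Real.sqrt_nonneg _

theorem abs_ite_zero_le {P : Prop} [Decidable P] {a c : ℝ} (h : |a| ≤ c) :
    |if P then a else 0| ≤ c * (if P then 1 else 0) := by
  split_ifs <;> simp [h]

/-- The vertical neighbours of a pixel, itself included, counted with weight two. -/
def rowWeight {M : ℕ} (i : Fin M) : ℝ :=
  2 * ((if (i : ℕ) + 1 < M then 1 else 0) + (if 1 ≤ (i : ℕ) then 1 else 0) + 1)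

theorem rowWeight_nonneg {M : ℕ} (i : Fin M) : 0 ≤ rowWeight i := by
  unfold rowWeight
  positivity

theorem sum_rowWeight (m : ℕ) : ∑ i : Fin (m + 1), rowWeight i = 6 * (m : ℝ) + 2 := by
  have h₁ : ∑ i : Fin (m + 1), (if (i : ℕ) + 1 < m + 1 then (1 : ℝ) else 0) = m := by
    rw [Fin.sum_univ_castSucc]
    simp
  have h₂ : ∑ i : Fin (m + 1), (if 1 ≤ (i : ℕ) then (1 : ℝ) else 0) = m := by
    rw [Fin.sum_univ_succ]
    simp
  simp only [rowWeight, ← Finset.mul_sum, Finset.sum_add_distrib, h₁, h₂]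
  simp
  ring

/-- There are at most `k` multiples of `n` below `k * n`. -/
theorem sum_indicator_dvd_le (k n : ℕ) (hn : 0 < n) :
    ∑ j : Fin (k * n), (if n ∣ (j : ℕ) then (1 : ℝ) else 0) ≤ k := by
  rw [Finset.sum_boole]
  have h : (Finset.univ.filter fun j : Fin (k * n) => n ∣ (j : ℕ)).card
      ≤ (Finset.range k).card := by
    refine Finset.card_le_card_of_injOn (fun j => (j : ℕ) / n) ?_ ?_
    · intro j _
      simpa using (Nat.div_lt_iff_lt_mul hn).2 j.isLt
    · intro a ha b hb hab
      simp only [Finset.coe_filter, Finset.mem_univ, true_and, Set.mem_ofPred_eq] at ha hb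
      exact Fin.ext (Nat.div_left_inj ha hb |>.1 hab)
  rw [Finset.card_range] at h
  exact_mod_cast h

theorem sum_sq_indicator_sub {ι : Type*} [Fintype ι] [DecidableEq ι] (s t : ι) (A C : ℝ) :
    ∑ b, ((if s = b then A else 0) - (if t = b then C else 0)) ^ 2
      = (A - C) ^ 2 + (if s = t then 0 else 2 * A * C) := by
  have h : ∀ b, ((if s = b then A else 0) - (if t = b then C else 0)) ^ 2
      = (if s = b then A ^ 2 else 0) + (if t = b then C ^ 2 else 0)
        - (if s = b then (if s = t then 2 * A * C else 0) else 0) := by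
    intro b
    split_ifs <;> first | (exfalso; simp_all; done) | ring
  simp only [h, Finset.sum_sub_distrib, Finset.sum_add_distrib, Finset.sum_ite_eq,
    Finset.mem_univ, if_true]
  split_ifs <;> ring

theorem sum_sq_divOp_stripe_le {M k n : ℕ} (hn : 0 < n) (p : Idx M (k * n) → ℝ × ℝ)
    (x : Idx M (k * n)) :
    ∑ b : Fin k, (divOp (projk
        (Finset.univ.filter fun x : Idx M (k * n) => (x.2 : ℕ) / n = (b : ℕ)) p) x) ^ 2
      ≤ (divOp p x) ^ 2
        + normWinf p ^ 2 * (rowWeight x.1 * (if n ∣ (x.2 : ℕ) then 1 else 0)) := by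
  obtain ⟨i, j⟩ := x
  have hlt : ∀ l : ℕ, l ≤ j → l / n < k := fun l hl =>
    (Nat.div_lt_iff_lt_mul hn).2 (hl.trans_lt j.isLt)
  set s : Fin k := ⟨(j : ℕ) / n, hlt _ le_rfl⟩ with hs
  set t : Fin k := ⟨((j : ℕ) - 1) / n, hlt _ (Nat.sub_le _ _)⟩ with ht
  set u : ℝ := if (i : ℕ) + 1 < M then (p (i, j)).1 else 0 with hu
  set v : ℝ := if 1 ≤ (i : ℕ) then
    (p (⟨(i : ℕ) - 1, lt_of_le_of_lt (Nat.sub_le _ _) i.isLt⟩, j)).1 else 0 with hv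
  set w : ℝ := if (j : ℕ) + 1 < k * n then (p (i, j)).2 else 0 with hw
  set C : ℝ := if 1 ≤ (j : ℕ) then
    (p (i, ⟨(j : ℕ) - 1, lt_of_le_of_lt (Nat.sub_le _ _) j.isLt⟩)).2 else 0 with hC
  have hdiv : divOp p (i, j) = (u - v + w) - C := by
    simp only [divOp, hu, hv, hw, hC]
    ring
  have hproj : ∀ b : Fin k, divOp (projk
      (Finset.univ.filter fun x : Idx M (k * n) => (x.2 : ℕ) / n = (b : ℕ)) p) (i, j)
      = (if s = b then u - v + w else 0) - (if t = b then C else 0) := by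
    intro b
    have hsb : s = b ↔ (j : ℕ) / n = b := by simp [hs, Fin.ext_iff]
    have htb : t = b ↔ ((j : ℕ) - 1) / n = b := by simp [ht, Fin.ext_iff]
    simp only [divOp, projk, Finset.mem_filter, Finset.mem_univ, true_and, hsb, htb, hu, hv, hw,
      hC]
    by_cases h₁ : (j : ℕ) / n = b <;> by_cases h₂ : ((j : ℕ) - 1) / n = b <;>
      simp only [h₁, h₂, if_true, if_false, Prod.fst_zero, Prod.snd_zero, ite_self] <;> ring
  simp only [hproj]
  rw [sum_sq_indicator_sub, hdiv]
  refine add_le_add_right ?_ _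
  have hP := normWinf_nonneg p
  split_ifs with hst hd hd
  · exact mul_nonneg (sq_nonneg _) (mul_nonneg (rowWeight_nonneg i) zero_le_one)
  · simp
  · have hcu := abs_ite_zero_le (P := (i : ℕ) + 1 < M) (abs_fst_le_normWinf p (i, j))
    have hcv := abs_ite_zero_le (P := 1 ≤ (i : ℕ)) (abs_fst_le_normWinf p
      (⟨(i : ℕ) - 1, lt_of_le_of_lt (Nat.sub_le _ _) i.isLt⟩, j))
    have hcw : |w| ≤ normWinf p := by
      rw [hw]
      split_ifs
      · exact abs_snd_le_normWinf p _
      · simpa using hP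
    have hcC : |C| ≤ normWinf p := by
      rw [hC]
      split_ifs
      · exact abs_snd_le_normWinf p _
      · simpa using hP
    rw [← hu] at hcu
    rw [← hv] at hcv
    have hA : |u - v + w| ≤ normWinf p * (rowWeight i / 2) := by
      have h := (abs_add_le (u - v) w).trans (add_le_add_left (abs_sub u v) _)
      unfold rowWeight
      linarith
    calc 2 * (u - v + w) * C ≤ 2 * (|u - v + w| * |C|) := by
          rw [← abs_mul, mul_assoc]
          exact mul_le_mul_of_nonneg_left (le_abs_self _) zero_le_two
      _ ≤ 2 * (normWinf p * (rowWeight i / 2) * normWinf p) := by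
          gcongr
          exact (abs_nonneg _).trans hA
      _ = normWinf p ^ 2 * (rowWeight i * 1) := by ring
  · refine absurd (Fin.ext ?_) hst
    have hj : (j : ℕ) - 1 + 1 = j := by
      have : (j : ℕ) ≠ 0 := fun h => hd (by simp [h])
      omega
    have h := Nat.succ_div (a := (j : ℕ) - 1) (b := n)
    rw [hj, if_neg hd] at h
    simpa [hs, ht] using h

theorem stripe_divergence_bound (M N Nd n : ℕ) (hn : 0 < n) (hN : N = Nd * n)
    (p : Idx M N → ℝ × ℝ) :
    ∑ b : Fin Nd, normVsq (divOp (projk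
        (Finset.univ.filter fun x : Idx M N => (x.2 : ℕ) / n = (b : ℕ)) p))
      ≤ normVsq (divOp p) + (Nd : ℝ) * (7 * (M : ℝ) - 5) * normWinf p ^ 2 := by
  subst hN
  rcases M with _ | m
  · simp [normVsq, normWinf]
  calc _ = ∑ x : Idx (m + 1) (Nd * n), ∑ b : Fin Nd, (divOp (projk (Finset.univ.filter
          fun x : Idx (m + 1) (Nd * n) => (x.2 : ℕ) / n = (b : ℕ)) p) x) ^ 2 :=
        Finset.sum_comm
    _ ≤ ∑ x : Idx (m + 1) (Nd * n), ((divOp p x) ^ 2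
          + normWinf p ^ 2 * (rowWeight x.1 * (if n ∣ (x.2 : ℕ) then 1 else 0))) :=
        Finset.sum_le_sum fun x _ => sum_sq_divOp_stripe_le hn p x
    _ = normVsq (divOp p) + normWinf p ^ 2 * ((∑ i : Fin (m + 1), rowWeight i)
          * ∑ j : Fin (Nd * n), (if n ∣ (j : ℕ) then (1 : ℝ) else 0)) := by
        rw [Finset.sum_add_distrib, ← Finset.mul_sum, Fintype.sum_mul_sum, normVsq]
        congr 2
        exact Fintype.sum_prod_type _
    _ ≤ normVsq (divOp p) + normWinf p ^ 2 * ((7 * (m : ℝ) + 2) * Nd) := by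
        rw [sum_rowWeight]
        gcongr
        · norm_num
        · exact sum_indicator_dvd_le Nd n hn
    _ = _ := by
        push_cast
        ring
end
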